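/- arXiv:2111.09434 — 2 statements merged into one kernel-verified Lean document; each statement's English description precedes it below -/
import Mathlib

section
/- (Riccati perturbation bound for the misspecified model.) Suppose ‖A_t − Â_t‖ ≤ ε_A and ‖B_t − B̂_t‖ ≤ ε_B for all t = 0,…,H−1. Then for every t = 0,…,H−1, ‖P*_t − P^CE_t‖ ≤ ‖A_t‖²‖P*_{t+1}‖²(2‖B_t‖‖R⁻¹‖ε_B + ‖R⁻¹‖ε_B²) + 2‖A_t‖‖P*_{t+1}‖ε_A + ‖P*_{t+1}‖ε_A² + (‖A_t‖ + ε_A)² · κ(P*_{t+1}) · κ(P^CE_{t+1}) · ‖P*_{t+1} − P^CE_{t+1}‖, where κ(P) = ‖P‖·‖P⁻¹‖ denotes the condition number (P*_{t+1} and P^CE_{t+1} are positive definite, hence invertible, since Q, Q_f, R are positive definite). -/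
open Matrix

/-- The operator norm of a real matrix induced by the Euclidean vector norm. -/
noncomputable def mnorm {m n : ℕ} (A : Matrix (Fin m) (Fin n) ℝ) : ℝ :=
  ‖LinearMap.toContinuousLinearMap (Matrix.toEuclideanLin A)‖

/-- The Euclidean norm of a real vector. -/
noncomputable def vnorm {n : ℕ} (x : Fin n → ℝ) : ℝ :=
  Real.sqrt (∑ i, x i ^ 2)

open scoped Matrix.Norms.L2Operator

theorem mnorm_eq_aux {m n : ℕ} (A : Matrix (Fin m) (Fin n) ℝ) : mnorm A = ‖A‖ := by
  rw [Matrix.l2_opNorm_def]; rfl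

theorem norm_tr_aux {m n : ℕ} (A : Matrix (Fin m) (Fin n) ℝ) : ‖Aᵀ‖ = ‖A‖ := by
  rw [← Matrix.conjTranspose_eq_transpose_of_trivial, Matrix.l2_opNorm_conjTranspose]

theorem one_add_inv_aux {n : ℕ} (M : Matrix (Fin n) (Fin n) ℝ) (hM : M.PosSemidef) :
    ‖(1 + M)⁻¹‖ ≤ 1 := by
  have hpd : (1 + M).PosDef := Matrix.PosDef.one.add_posSemidef hM
  have hu : IsUnit (1 + M).det := (Matrix.isUnit_iff_isUnit_det _).1 hpd.isUnit
  rw [Matrix.l2_opNorm_def]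
  refine ContinuousLinearMap.opNorm_le_bound _ zero_le_one (fun x => ?_)
  rw [one_mul]
  set y := (LinearMap.toContinuousLinearMap (Matrix.toEuclideanLin (1 + M)⁻¹)) x with hy
  have hy' : y.ofLp = (1 + M)⁻¹ *ᵥ x.ofLp := by
    simp [hy, Matrix.toEuclideanLin]
  have hx : x.ofLp = y.ofLp + M *ᵥ y.ofLp := by
    rw [hy']
    rw [← Matrix.one_mulVec ((1 + M)⁻¹ *ᵥ x.ofLp), Matrix.mulVec_mulVec, Matrix.mulVec_mulVec, ← Matrix.add_mulVec]
    simp only [mul_one]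
    rw [← Matrix.mul_assoc, ← add_mul, mul_one, Matrix.mul_nonsing_inv _ hu, Matrix.one_mulVec]
  have h1 : inner ℝ y x = inner ℝ y y + y.ofLp ⬝ᵥ (M *ᵥ y.ofLp) := by
    simp only [EuclideanSpace.inner_eq_star_dotProduct, hx]
    simp [add_dotProduct, dotProduct_comm]
  have h2 : 0 ≤ y.ofLp ⬝ᵥ (M *ᵥ y.ofLp) := by
    simpa using hM.dotProduct_mulVec_nonneg y.ofLp
  have h3 := real_inner_le_norm y x
  rw [h1, real_inner_self_eq_norm_sq] at h3
  change ‖y‖ ≤ ‖x‖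
  by_contra! h
  nlinarith [norm_nonneg x, norm_nonneg y]

/-- basic facts about `P (1 + S P)⁻¹`. -/
theorem F_aux {n : ℕ} (P S : Matrix (Fin n) (Fin n) ℝ) (hP : P.PosSemidef) (hS : S.PosSemidef) :
    IsUnit (1 + S * P).det ∧ (P * (1 + S * P)⁻¹).PosSemidef ∧ ‖P * (1 + S * P)⁻¹‖ ≤ ‖P‖ := by
  obtain ⟨C, hC⟩ : ∃ C : Matrix (Fin n) (Fin n) ℝ, P = Cᴴ * C := by
    open scoped MatrixOrder in
    obtain ⟨C, hC⟩ := CStarAlgebra.nonneg_iff_eq_star_mul_self.1 hP.nonneg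
    exact ⟨C, hC⟩
  have hM : (C * S * Cᴴ).PosSemidef := hS.mul_mul_conjTranspose_same C
  have hpd : (1 + C * S * Cᴴ).PosDef := Matrix.PosDef.one.add_posSemidef hM
  have hu : IsUnit (1 + C * S * Cᴴ).det := (Matrix.isUnit_iff_isUnit_det _).1 hpd.isUnit
  have hu2 : IsUnit (1 + S * P).det := by
    rw [hC, ← Matrix.mul_assoc, Matrix.det_one_add_mul_comm, ← Matrix.mul_assoc]; exact hu
  have hF : P * (1 + S * P)⁻¹ = Cᴴ * (1 + C * S * Cᴴ)⁻¹ * C := by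
    have e : (1 + C * S * Cᴴ) * C = C * (1 + S * P) := by
      rw [hC]; noncomm_ring
    have e2 : C * (1 + S * P)⁻¹ = (1 + C * S * Cᴴ)⁻¹ * C := by
      calc C * (1 + S * P)⁻¹ = (1 + C * S * Cᴴ)⁻¹ * ((1 + C * S * Cᴴ) * C) * (1 + S * P)⁻¹ := by
            rw [← Matrix.mul_assoc, Matrix.nonsing_inv_mul _ hu, one_mul]
        _ = _ := by
            rw [e, Matrix.mul_assoc _ (C * _), Matrix.mul_assoc C (1 + S * P), Matrix.mul_nonsing_inv _ hu2, mul_one]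
    rw [Matrix.mul_assoc, ← e2, ← Matrix.mul_assoc, ← hC]
  refine ⟨hu2, ?_, ?_⟩
  · rw [hF]
    exact hpd.inv.posSemidef.conjTranspose_mul_mul_same C
  · rw [hF]
    have h1 := Matrix.l2_opNorm_mul (Cᴴ * (1 + C * S * Cᴴ)⁻¹) C
    have h2 := Matrix.l2_opNorm_mul Cᴴ (1 + C * S * Cᴴ)⁻¹
    have h3 := one_add_inv_aux _ hM
    have h4 : ‖P‖ = ‖C‖ * ‖C‖ := by rw [hC, Matrix.l2_opNorm_conjTranspose_mul_self]
    rw [Matrix.l2_opNorm_conjTranspose] at h2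
    rw [h4]
    refine h1.trans (mul_le_mul_of_nonneg_right (h2.trans ?_) (norm_nonneg _))
    exact mul_le_of_le_one_right (norm_nonneg _) h3

theorem step_posDef_aux {n d : ℕ} (A P Q : Matrix (Fin n) (Fin n) ℝ) (B : Matrix (Fin n) (Fin d) ℝ)
    (R : Matrix (Fin d) (Fin d) ℝ) (hQ : Q.PosDef) (hR : R.PosDef) (hP : P.PosDef) :
    (Q + Aᵀ * P * (1 + B * R⁻¹ * Bᵀ * P)⁻¹ * A).PosDef := by
  have hS : (B * R⁻¹ * Bᵀ).PosSemidef := by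
    simpa using hR.inv.posSemidef.mul_mul_conjTranspose_same B
  have h := (F_aux P _ hP.posSemidef hS).2.1.conjTranspose_mul_mul_same A
  rw [Matrix.conjTranspose_eq_transpose_of_trivial, ← Matrix.mul_assoc] at h
  exact hQ.add_posSemidef h

theorem riccati_posDef_aux {n d H : ℕ} (A : ℕ → Matrix (Fin n) (Fin n) ℝ)
    (B : ℕ → Matrix (Fin n) (Fin d) ℝ)
    (Q Qf : Matrix (Fin n) (Fin n) ℝ) (R : Matrix (Fin d) (Fin d) ℝ)
    (hQ : Q.PosDef) (hQf : Qf.PosDef) (hR : R.PosDef)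
    (P : ℕ → Matrix (Fin n) (Fin n) ℝ) (hPH : P H = Qf)
    (hP : ∀ t, t < H → P t =
      Q + (A t)ᵀ * P (t+1) * (1 + B t * R⁻¹ * (B t)ᵀ * P (t+1))⁻¹ * A t) :
    ∀ t, t ≤ H → (P t).PosDef := by
  intro t ht
  induction ht using Nat.decreasingInduction with
  | self => rw [hPH]; exact hQf
  | of_succ k hk ih =>
    rw [hP k hk]
    exact step_posDef_aux _ _ _ _ _ hQ hR ih

theorem norm_mul3_aux {a b c d : ℕ} (X : Matrix (Fin a) (Fin b) ℝ) (Y : Matrix (Fin b) (Fin c) ℝ)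
    (Z : Matrix (Fin c) (Fin d) ℝ) {x y z : ℝ} (hx : ‖X‖ ≤ x) (hy : ‖Y‖ ≤ y) (hz : ‖Z‖ ≤ z) :
    ‖X * Y * Z‖ ≤ x * y * z := by
  have h1 := Matrix.l2_opNorm_mul (X * Y) Z
  have h2 := Matrix.l2_opNorm_mul X Y
  have hx0 := (norm_nonneg X).trans hx
  have hy0 := (norm_nonneg Y).trans hy
  refine h1.trans ?_
  refine mul_le_mul (h2.trans ?_) hz (norm_nonneg _) (by positivity)
  exact mul_le_mul hx hy (norm_nonneg _) hx0

theorem quad_diff_aux {m n : ℕ} (X D : Matrix (Fin m) (Fin n) ℝ) (G : Matrix (Fin m) (Fin m) ℝ)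
    {e g : ℝ} (hD : ‖D‖ ≤ e) (hG : ‖G‖ ≤ g) :
    ‖Xᵀ * G * X - (X - D)ᵀ * G * (X - D)‖ ≤ 2 * ‖X‖ * g * e + g * e ^ 2 := by
  have e1 : Xᵀ * G * X - (X - D)ᵀ * G * (X - D) = Xᵀ * G * D + Dᵀ * G * X - Dᵀ * G * D := by
    simp only [Matrix.transpose_sub, Matrix.sub_mul, Matrix.mul_sub]; abel
  have hX : ‖Xᵀ‖ ≤ ‖X‖ := (norm_tr_aux X).le
  have hDt : ‖Dᵀ‖ ≤ e := (norm_tr_aux D).le.trans hD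
  rw [e1]
  have h1 := norm_mul3_aux Xᵀ G D hX hG hD
  have h2 := norm_mul3_aux Dᵀ G X hDt hG le_rfl
  have h3 := norm_mul3_aux Dᵀ G D hDt hG hD
  have h4 := norm_sub_le (Xᵀ * G * D + Dᵀ * G * X) (Dᵀ * G * D)
  have h5 := norm_add_le (Xᵀ * G * D) (Dᵀ * G * X)
  linarith

theorem F_diffS_aux {n : ℕ} (P S T : Matrix (Fin n) (Fin n) ℝ) (hP : P.PosDef)
    (hS : S.PosSemidef) (hT : T.PosSemidef) (P' : Matrix (Fin n) (Fin n) ℝ) (hP' : P'.PosDef) :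
    P * (1 + S * P)⁻¹ - P' * (1 + T * P')⁻¹ =
      (P * (1 + S * P)⁻¹) * (T + P'⁻¹ - S - P⁻¹) * (P' * (1 + T * P')⁻¹) := by
  have h : ∀ (P S : Matrix (Fin n) (Fin n) ℝ), P.PosDef → S.PosSemidef →
      (S + P⁻¹) * (P * (1 + S * P)⁻¹) = 1 := by
    intro P S hP hS
    have hu := (F_aux P S hP.posSemidef hS).1
    have hp : IsUnit P.det := (Matrix.isUnit_iff_isUnit_det _).1 hP.isUnit
    rw [← Matrix.mul_assoc, Matrix.add_mul, Matrix.nonsing_inv_mul _ hp, add_comm,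
      Matrix.mul_nonsing_inv _ hu]
  have h1 := mul_eq_one_comm.1 (h P S hP hS)
  have h2 := h P' T hP' hT
  set F := P * (1 + S * P)⁻¹
  set G := P' * (1 + T * P')⁻¹
  have : F * (T + P'⁻¹ - S - P⁻¹) * G = F * ((T + P'⁻¹) * G) - (F * (S + P⁻¹)) * G := by
    noncomm_ring
  rw [this, h1, h2, mul_one, one_mul]

/-- (Theorem 2 of the paper: Riccati perturbation bound for the
misspecified model), with `κ(P) = ‖P‖·‖P⁻¹‖` the condition number. -/
theorem statement12
    (n d H : ℕ)
    (A Ahat : ℕ → Matrix (Fin n) (Fin n) ℝ) (B Bhat : ℕ → Matrix (Fin n) (Fin d) ℝ)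
    (Q Qf : Matrix (Fin n) (Fin n) ℝ) (R : Matrix (Fin d) (Fin d) ℝ)
    (hQ : Q.PosDef) (hQf : Qf.PosDef) (hR : R.PosDef)
    (Pstar PCE : ℕ → Matrix (Fin n) (Fin n) ℝ)
    -- optimal Riccati recursion
    (hPH : Pstar H = Qf)
    (hP : ∀ t, t < H → Pstar t =
      Q + (A t)ᵀ * Pstar (t+1) * (1 + B t * R⁻¹ * (B t)ᵀ * Pstar (t+1))⁻¹ * A t)
    -- misspecified-model Riccati recursion
    (hPCEH : PCE H = Qf)
    (hPCE : ∀ t, t < H → PCE t =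
      Q + (Ahat t)ᵀ * PCE (t+1) *
        (1 + Bhat t * R⁻¹ * (Bhat t)ᵀ * PCE (t+1))⁻¹ * Ahat t)
    -- modeling errors
    (εA εB : ℝ)
    (hεA : ∀ t, t < H → mnorm (A t - Ahat t) ≤ εA)
    (hεB : ∀ t, t < H → mnorm (B t - Bhat t) ≤ εB) :
    ∀ t, t < H →
      mnorm (Pstar t - PCE t) ≤
        mnorm (A t) ^ 2 * mnorm (Pstar (t+1)) ^ 2 *
          (2 * mnorm (B t) * mnorm R⁻¹ * εB + mnorm R⁻¹ * εB ^ 2) +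
        2 * mnorm (A t) * mnorm (Pstar (t+1)) * εA +
        mnorm (Pstar (t+1)) * εA ^ 2 +
        (mnorm (A t) + εA) ^ 2 *
          (mnorm (Pstar (t+1)) * mnorm ((Pstar (t+1))⁻¹)) *
          (mnorm (PCE (t+1)) * mnorm ((PCE (t+1))⁻¹)) *
          mnorm (Pstar (t+1) - PCE (t+1)) := by
  intro t ht
  have hPs := riccati_posDef_aux A B Q Qf R hQ hQf hR Pstar hPH hP (t+1) ht
  have hPc := riccati_posDef_aux Ahat Bhat Q Qf R hQ hQf hR PCE hPCEH hPCE (t+1) ht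
  have hA := hεA t ht
  have hB := hεB t ht
  rw [hP t ht, hPCE t ht]
  simp only [mnorm_eq_aux] at *
  generalize Pstar (t+1) = P at *
  generalize PCE (t+1) = P' at *
  generalize A t = A at *
  generalize B t = B at *
  generalize Ahat t = A' at *
  generalize Bhat t = B' at *
  have hS : (B * R⁻¹ * Bᵀ).PosSemidef := by
    simpa using hR.inv.posSemidef.mul_mul_conjTranspose_same B
  have hS' : (B' * R⁻¹ * B'ᵀ).PosSemidef := by
    simpa using hR.inv.posSemidef.mul_mul_conjTranspose_same B'
  have hSd : ‖B * R⁻¹ * Bᵀ - B' * R⁻¹ * B'ᵀ‖ ≤ 2 * ‖B‖ * ‖R⁻¹‖ * εB + ‖R⁻¹‖ * εB ^ 2 := by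
    have h := quad_diff_aux Bᵀ (B - B')ᵀ R⁻¹ ((norm_tr_aux _).le.trans hB) le_rfl
    simpa [norm_tr_aux] using h
  set S := B * R⁻¹ * Bᵀ
  set S' := B' * R⁻¹ * B'ᵀ
  have hA0 : 0 ≤ εA := (norm_nonneg _).trans hA
  have hA' : ‖A'‖ ≤ ‖A‖ + εA := by
    have := norm_sub_le A (A - A')
    rw [sub_sub_cancel] at this
    linarith
  have hF1 := (F_aux P S hPs.posSemidef hS).2.2
  have hF2 := (F_aux P S' hPs.posSemidef hS').2.2
  have hF3 := (F_aux P' S' hPc.posSemidef hS').2.2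
  have d1 := F_diffS_aux P S S' hPs hS hS' P hPs
  have d2 := F_diffS_aux P S' S' hPs hS' hS' P' hPc
  simp only [Matrix.mul_assoc Aᵀ P, Matrix.mul_assoc A'ᵀ P']
  set F1 := P * (1 + S * P)⁻¹
  set F2 := P * (1 + S' * P)⁻¹
  set F3 := P' * (1 + S' * P')⁻¹
  have n1 : ‖F1 - F2‖ ≤ ‖P‖ * (2 * ‖B‖ * ‖R⁻¹‖ * εB + ‖R⁻¹‖ * εB ^ 2) * ‖P‖ := by
    rw [d1]
    refine norm_mul3_aux _ _ _ hF1 ?_ hF2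
    rw [show S' + P⁻¹ - S - P⁻¹ = -(S - S') by abel, norm_neg]
    exact hSd
  have n2 : ‖F2 - F3‖ ≤ ‖P‖ * (‖P'⁻¹‖ * ‖P - P'‖ * ‖P⁻¹‖) * ‖P'‖ := by
    rw [d2]
    refine norm_mul3_aux _ _ _ hF2 ?_ hF3
    have hp : IsUnit P.det := (Matrix.isUnit_iff_isUnit_det _).1 hPs.isUnit
    have hp' : IsUnit P'.det := (Matrix.isUnit_iff_isUnit_det _).1 hPc.isUnit
    have : S' + P'⁻¹ - S' - P⁻¹ = P'⁻¹ * (P - P') * P⁻¹ := by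
      rw [Matrix.mul_sub, Matrix.sub_mul, Matrix.nonsing_inv_mul _ hp', Matrix.mul_assoc,
        Matrix.mul_nonsing_inv _ hp, mul_one, one_mul]
      abel
    rw [this]
    exact norm_mul3_aux _ _ _ le_rfl le_rfl le_rfl
  have key : Q + Aᵀ * F1 * A - (Q + A'ᵀ * F3 * A') =
      Aᵀ * (F1 - F2) * A + (Aᵀ * F2 * A - (A - (A - A'))ᵀ * F2 * (A - (A - A'))) +
        A'ᵀ * (F2 - F3) * A' := by
    rw [sub_sub_cancel]; noncomm_ring
  rw [key]
  have t1 := norm_mul3_aux Aᵀ (F1 - F2) A (norm_tr_aux A).le n1 le_rfl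
  have t2 := quad_diff_aux A (A - A') F2 hA hF2
  have t3 := norm_mul3_aux A'ᵀ (F2 - F3) A' ((norm_tr_aux A').le.trans hA') n2 hA'
  refine (norm_add₃_le).trans ((add_le_add (add_le_add t1 t2) t3).trans (le_of_eq ?_))
  ring
end

section
/- (Suboptimality of iterative learning control under modeling error only at the first time step.) There is an absolute constant C > 0 with the following property. Suppose d ≤ n, σ̲(R) ≥ 1, Â_t = A_t and B̂_t = B_t for all t = 1,…,H−1, ‖A_0 − Â_0‖ ≤ ε_A and ‖B_0 − B̂_0‖ ≤ ε_B with 0 < ε_A, ε_B < Γ, each R + B̂_tᵀ P^ILC_{t+1} B_t is invertible with ‖(R + B̂_tᵀ P^ILC_{t+1} B_t)v‖ ≥ σ̲(R)‖v‖ for all v, ‖A_t + B_t K*_t‖ ≤ 1 − δ for some 0 < δ ≤ 1 and all t, and ‖K*_t − K^ILC_t‖ ≤ δ/(2‖B_t‖) for all t. Then V^ILC_0(x_0) − V*_0(x_0) ≤ C·d·Γ⁹·‖x_0‖²·(ε_A + ε_B)², where V^ILC_0(x_0) is the closed-loop cost of the controller (K^ILC_0,…,K^ILC_{H−1}) on the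 true system. -/
open Matrix

lemma vnorm_eq' {n : ℕ} (x : Fin n → ℝ) : vnorm x = ‖WithLp.toLp 2 x‖ := by
  simp [vnorm, EuclideanSpace.norm_eq]

lemma vnorm_nonneg' {n : ℕ} (x : Fin n → ℝ) : 0 ≤ vnorm x := Real.sqrt_nonneg _

lemma vnorm_add_le' {n : ℕ} (x y : Fin n → ℝ) : vnorm (x + y) ≤ vnorm x + vnorm y := by
  simp only [vnorm_eq', WithLp.toLp_add]
  exact norm_add_le _ _

lemma mnorm_nonneg' {m n : ℕ} (A : Matrix (Fin m) (Fin n) ℝ) : 0 ≤ mnorm A := norm_nonneg _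

lemma vnorm_mulVec_le' {m n : ℕ} (A : Matrix (Fin m) (Fin n) ℝ) (x : Fin n → ℝ) :
    vnorm (A.mulVec x) ≤ mnorm A * vnorm x := by
  have h := (LinearMap.toContinuousLinearMap (Matrix.toEuclideanLin A)).le_opNorm (WithLp.toLp 2 x)
  rw [vnorm_eq', vnorm_eq']
  exact h

lemma dot_le' {n : ℕ} (x y : Fin n → ℝ) : x ⬝ᵥ y ≤ vnorm x * vnorm y := by
  have h := real_inner_le_norm (WithLp.toLp 2 x : EuclideanSpace ℝ (Fin n)) (WithLp.toLp 2 y)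
  rw [vnorm_eq', vnorm_eq']
  simpa [PiLp.inner_apply, dotProduct, mul_comm] using h

open scoped Matrix.Norms.L2Operator in
lemma mnorm_transpose' {m n : ℕ} (A : Matrix (Fin m) (Fin n) ℝ) : mnorm Aᵀ = mnorm A := by
  have h := Matrix.l2_opNorm_conjTranspose A
  rw [Matrix.l2_opNorm_def, Matrix.l2_opNorm_def, Matrix.conjTranspose_eq_transpose_of_trivial] at h
  exact h

lemma M_posDef {n d : ℕ} (B : Matrix (Fin n) (Fin d) ℝ) (R : Matrix (Fin d) (Fin d) ℝ)
    (P : Matrix (Fin n) (Fin n) ℝ) (hR : R.PosDef) (hP : P.PosDef) :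
    (R + Bᵀ * P * B).PosDef := by
  have h := hP.posSemidef.conjTranspose_mul_mul_same B
  rw [Matrix.conjTranspose_eq_transpose_of_trivial] at h
  exact hR.add_posSemidef h

lemma one_step {n d : ℕ} (A P Q Pt : Matrix (Fin n) (Fin n) ℝ) (B : Matrix (Fin n) (Fin d) ℝ)
    (R : Matrix (Fin d) (Fin d) ℝ) (Ks K : Matrix (Fin d) (Fin n) ℝ)
    (hR : R.PosDef) (hP : P.PosDef)
    (hPt : Pt = Q + Aᵀ * P * (1 + B * R⁻¹ * Bᵀ * P)⁻¹ * A)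
    (hK : Ks = -((R + Bᵀ * P * B)⁻¹ * (Bᵀ * P * A))) :
    Q + Kᵀ * R * K + (A + B * K)ᵀ * P * (A + B * K) =
      Pt + (K - Ks)ᵀ * (R + Bᵀ * P * B) * (K - Ks) := by
  have hM := M_posDef B R P hR hP
  have hPs : Pᵀ = P := by
    have := hP.isHermitian.eq; rwa [Matrix.conjTranspose_eq_transpose_of_trivial] at this
  have hMs : (R + Bᵀ * P * B)ᵀ = R + Bᵀ * P * B := by
    have := hM.isHermitian.eq; rwa [Matrix.conjTranspose_eq_transpose_of_trivial] at this
  have hMu : IsUnit (R + Bᵀ * P * B).det := (Matrix.isUnit_iff_isUnit_det _).1 hM.isUnit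
  have hRu : IsUnit R.det := (Matrix.isUnit_iff_isUnit_det _).1 hR.isUnit
  have hMdef : Bᵀ * P * B = (R + Bᵀ * P * B) - R := by abel
  have hinv : (1 + B * R⁻¹ * Bᵀ * P)⁻¹ = 1 - B * (R + Bᵀ * P * B)⁻¹ * (Bᵀ * P) := by
    apply Matrix.inv_eq_right_inv
    have e : R⁻¹ * (Bᵀ * P * B) * (R + Bᵀ * P * B)⁻¹ = R⁻¹ - (R + Bᵀ * P * B)⁻¹ := by
      nth_rewrite 1 [hMdef]
      rw [Matrix.mul_sub, Matrix.sub_mul, Matrix.mul_assoc, Matrix.mul_nonsing_inv _ hMu,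
        Matrix.nonsing_inv_mul _ hRu]
      simp
    have e2 : (1 + B * R⁻¹ * Bᵀ * P) * (1 - B * (R + Bᵀ * P * B)⁻¹ * (Bᵀ * P)) =
      1 + B * (R⁻¹ - (R + Bᵀ * P * B)⁻¹ - R⁻¹ * (Bᵀ * P * B) * (R + Bᵀ * P * B)⁻¹) * (Bᵀ * P) := by
      generalize (R + Bᵀ * P * B)⁻¹ = N
      generalize R⁻¹ = S
      simp only [Matrix.mul_sub, Matrix.sub_mul, Matrix.mul_add, Matrix.add_mul, Matrix.mul_one,
        Matrix.one_mul, Matrix.mul_assoc]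
      abel
    rw [e2, e]; simp
  have hMK : (R + Bᵀ * P * B) * Ks = -(Bᵀ * P * A) := by
    rw [hK, Matrix.mul_neg, ← Matrix.mul_assoc, Matrix.mul_nonsing_inv _ hMu, Matrix.one_mul]
  have hKM : Ksᵀ * (R + Bᵀ * P * B) = -(Aᵀ * P * B) := by
    have := congrArg Matrix.transpose hMK
    rw [Matrix.transpose_mul, hMs] at this
    rw [this]
    simp [Matrix.transpose_mul, hPs, Matrix.mul_assoc]
  have hPt' : Pt = Q + Aᵀ * P * A + Aᵀ * P * B * Ks := by
    rw [hPt, hinv, hK]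
    simp only [Matrix.mul_sub, Matrix.sub_mul, Matrix.mul_one, Matrix.mul_neg, Matrix.mul_assoc]
    abel
  have hexp : (K - Ks)ᵀ * (R + Bᵀ * P * B) * (K - Ks) =
      Kᵀ * (R + Bᵀ * P * B) * K - Kᵀ * ((R + Bᵀ * P * B) * Ks)
        - (Ksᵀ * (R + Bᵀ * P * B)) * K + (Ksᵀ * (R + Bᵀ * P * B)) * Ks := by
    generalize R + Bᵀ * P * B = M
    simp only [Matrix.transpose_sub, Matrix.mul_sub, Matrix.sub_mul, Matrix.mul_assoc]
    abel
  rw [hexp, hMK, hKM, hPt']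
  simp only [Matrix.transpose_add, Matrix.transpose_mul, Matrix.mul_add, Matrix.add_mul,
    Matrix.mul_neg, Matrix.neg_mul, Matrix.mul_assoc]
  abel

lemma quad_eq {m n : ℕ} (K : Matrix (Fin m) (Fin n) ℝ) (M : Matrix (Fin m) (Fin m) ℝ)
    (x : Fin n → ℝ) : x ⬝ᵥ (Kᵀ * M * K).mulVec x = K.mulVec x ⬝ᵥ M.mulVec (K.mulVec x) := by
  rw [← Matrix.mulVec_mulVec, ← Matrix.mulVec_mulVec, Matrix.dotProduct_mulVec,
    Matrix.vecMul_transpose]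

lemma step_posDef {n d : ℕ} (A P Q Pt : Matrix (Fin n) (Fin n) ℝ) (B : Matrix (Fin n) (Fin d) ℝ)
    (R : Matrix (Fin d) (Fin d) ℝ) 
    (hR : R.PosDef) (hP : P.PosDef) (hQ : Q.PosDef)
    (hPt : Pt = Q + Aᵀ * P * (1 + B * R⁻¹ * Bᵀ * P)⁻¹ * A) : Pt.PosDef := by
  obtain ⟨K, hK⟩ : ∃ K, K = -((R + Bᵀ * P * B)⁻¹ * (Bᵀ * P * A)) := ⟨_, rfl⟩
  have h := one_step A P Q Pt B R K K hR hP hPt hK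
  rw [sub_self, Matrix.mul_zero, add_zero] at h
  rw [← h]
  have h1 := hR.posSemidef.conjTranspose_mul_mul_same K
  have h2 := hP.posSemidef.conjTranspose_mul_mul_same (A + B * K)
  rw [Matrix.conjTranspose_eq_transpose_of_trivial] at h1 h2
  exact (hQ.add_posSemidef h1).add_posSemidef h2

lemma err_bound {n d : ℕ} (A P : Matrix (Fin n) (Fin n) ℝ) (B Bh : Matrix (Fin n) (Fin d) ℝ)
    (R : Matrix (Fin d) (Fin d) ℝ) (Ks K : Matrix (Fin d) (Fin n) ℝ) (x : Fin n → ℝ)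
    (εA εB Γ σR : ℝ)
    (hR : R.PosDef) (hP : P.PosDef) (hσ : 1 ≤ σR)
    (hKs : Ks = -((R + Bᵀ * P * B)⁻¹ * (Bᵀ * P * A)))
    (hK : K = -((R + Bhᵀ * P * B)⁻¹ * (Bhᵀ * P * A)))
    (hu : IsUnit (R + Bhᵀ * P * B))
    (hl : ∀ v : Fin d → ℝ, σR * vnorm v ≤ vnorm ((R + Bhᵀ * P * B).mulVec v))
    (hE : mnorm (B - Bh) ≤ εB) (hεA : 0 < εA) (hεB : 0 < εB) (hεΓ : εB < Γ)
    (hB : 1 + mnorm B ≤ Γ) (hPΓ : 1 + mnorm P ≤ Γ) (hst : mnorm (A + B * Ks) ≤ 1) :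
    (K - Ks).mulVec x ⬝ᵥ (R + Bᵀ * P * B).mulVec ((K - Ks).mulVec x) ≤
      2 * d * Γ ^ 9 * vnorm x ^ 2 * (εA + εB) ^ 2 := by
  rcases Nat.eq_zero_or_pos d with rfl | hd
  · simp [dotProduct]
  have hM := M_posDef B R P hR hP
  have hMu : IsUnit (R + Bᵀ * P * B).det := (Matrix.isUnit_iff_isUnit_det _).1 hM.isUnit
  have hMu' := (Matrix.isUnit_iff_isUnit_det _).1 hu
  have hMK : (R + Bᵀ * P * B) * Ks = -(Bᵀ * P * A) := by
    rw [hKs, Matrix.mul_neg, ← Matrix.mul_assoc, Matrix.mul_nonsing_inv _ hMu, Matrix.one_mul]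
  have hMK' : (R + Bhᵀ * P * B) * K = -(Bhᵀ * P * A) := by
    rw [hK, Matrix.mul_neg, ← Matrix.mul_assoc, Matrix.mul_nonsing_inv _ hMu', Matrix.one_mul]
  have hdiff : R + Bᵀ * P * B = (R + Bhᵀ * P * B) + (B - Bh)ᵀ * (P * B) := by
    simp only [Matrix.transpose_sub, Matrix.sub_mul, Matrix.mul_assoc]; abel
  have hD : (R + Bhᵀ * P * B) * (K - Ks) = (B - Bh)ᵀ * (P * (A + B * Ks)) := by
    have h1 : (R + Bhᵀ * P * B) * Ks = -(Bᵀ * P * A) - (B - Bh)ᵀ * (P * B) * Ks := by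
      rw [← hMK, hdiff, Matrix.add_mul (R + Bhᵀ * P * B), add_sub_cancel_right]
    rw [Matrix.mul_sub, hMK', h1]
    simp only [Matrix.transpose_sub, Matrix.sub_mul, Matrix.mul_add, Matrix.mul_assoc]; abel
  obtain ⟨y, hy⟩ : ∃ y, y = (K - Ks).mulVec x := ⟨_, rfl⟩
  rw [← hy]
  have hw : (R + Bhᵀ * P * B).mulVec y =
      (B - Bh)ᵀ.mulVec (P.mulVec ((A + B * Ks).mulVec x)) := by
    rw [hy, Matrix.mulVec_mulVec, hD, Matrix.mulVec_mulVec, Matrix.mulVec_mulVec, Matrix.mul_assoc]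
  have hΓ : 1 ≤ Γ := by linarith [mnorm_nonneg' B]
  have bE : ∀ v, vnorm ((B - Bh)ᵀ.mulVec v) ≤ εB * vnorm v := fun v =>
    (vnorm_mulVec_le' _ v).trans (by
      rw [mnorm_transpose']; exact mul_le_mul_of_nonneg_right hE (vnorm_nonneg' _))
  have bP : ∀ v, vnorm (P.mulVec v) ≤ Γ * vnorm v := fun v =>
    (vnorm_mulVec_le' _ v).trans
      (mul_le_mul_of_nonneg_right (by linarith) (vnorm_nonneg' _))
  have bB : ∀ v, vnorm (B.mulVec v) ≤ Γ * vnorm v := fun v =>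
    (vnorm_mulVec_le' _ v).trans
      (mul_le_mul_of_nonneg_right (by linarith) (vnorm_nonneg' _))
  have bS : vnorm ((A + B * Ks).mulVec x) ≤ 1 * vnorm x :=
    (vnorm_mulVec_le' _ x).trans
      (mul_le_mul_of_nonneg_right hst (vnorm_nonneg' _))
  have hx := vnorm_nonneg' x
  have hyn := vnorm_nonneg' y
  have bw : vnorm ((R + Bhᵀ * P * B).mulVec y) ≤ εB * (Γ * vnorm x) := by
    rw [hw]
    refine (bE _).trans (mul_le_mul_of_nonneg_left ((bP _).trans ?_) hεB.le)
    exact mul_le_mul_of_nonneg_left (by linarith) (by linarith)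
  have by' : vnorm y ≤ εB * (Γ * vnorm x) := by
    have := hl y
    nlinarith
  have bM : vnorm ((R + Bᵀ * P * B).mulVec y) ≤
      εB * (Γ * vnorm x) + εB * (Γ * (Γ * vnorm y)) := by
    rw [hdiff, Matrix.add_mulVec]
    refine (vnorm_add_le' _ _).trans (add_le_add bw ?_)
    rw [← Matrix.mulVec_mulVec, ← Matrix.mulVec_mulVec]
    refine (bE _).trans (mul_le_mul_of_nonneg_left ((bP _).trans ?_) hεB.le)
    exact mul_le_mul_of_nonneg_left (bB _) (by linarith)
  obtain ⟨a, ha⟩ : ∃ a, a = εB * (Γ * vnorm x) := ⟨_, rfl⟩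
  rw [← ha] at by' bM
  have ha0 : 0 ≤ a := hyn.trans by'
  have h3 : εB * (Γ * (Γ * vnorm y)) ≤ Γ ^ 3 * a := by
    calc εB * (Γ * (Γ * vnorm y)) ≤ Γ * (Γ * (Γ * a)) := by gcongr
      _ = _ := by ring
  have h4 : y ⬝ᵥ (R + Bᵀ * P * B).mulVec y ≤ a * (a + Γ ^ 3 * a) :=
    (dot_le' _ _).trans (mul_le_mul by' (bM.trans (by linarith)) (vnorm_nonneg' _) ha0)
  have hd1 : (1 : ℝ) ≤ d := by exact_mod_cast hd
  have h5 : Γ ^ 2 * (1 + Γ ^ 3) ≤ 2 * Γ ^ 9 := by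
    have e1 : Γ ^ 2 ≤ Γ ^ 9 := pow_le_pow_right₀ hΓ (by norm_num)
    have e2 : Γ ^ 5 ≤ Γ ^ 9 := pow_le_pow_right₀ hΓ (by norm_num)
    nlinarith
  have h6 : εB ^ 2 ≤ (εA + εB) ^ 2 := by gcongr; linarith
  have hΓ9 : 0 ≤ Γ ^ 9 := by positivity
  calc _ ≤ a * (a + Γ ^ 3 * a) := h4
    _ = (Γ ^ 2 * (1 + Γ ^ 3)) * vnorm x ^ 2 * εB ^ 2 := by rw [ha]; ring
    _ ≤ (2 * Γ ^ 9) * vnorm x ^ 2 * (εA + εB) ^ 2 := by gcongr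
    _ = 1 * ((2 * Γ ^ 9) * vnorm x ^ 2 * (εA + εB) ^ 2) := by ring
    _ ≤ d * ((2 * Γ ^ 9) * vnorm x ^ 2 * (εA + εB) ^ 2) := by gcongr
    _ = _ := by ring

/-- suboptimality of iterative learning control under modeling error only
at the first time step: there is an absolute constant `C > 0` such that
`V^ILC_0(x_0) - V*_0(x_0) ≤ C d Γ⁹ ‖x_0‖² (ε_A + ε_B)²`. -/
theorem statement17 :
    ∃ C : ℝ, 0 < C ∧
      ∀ (n d H : ℕ)
        (A Ahat : ℕ → Matrix (Fin n) (Fin n) ℝ)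
        (B Bhat : ℕ → Matrix (Fin n) (Fin d) ℝ)
        (Q Qf : Matrix (Fin n) (Fin n) ℝ) (R : Matrix (Fin d) (Fin d) ℝ)
        (Pstar PILC : ℕ → Matrix (Fin n) (Fin n) ℝ)
        (Kstar KILC : ℕ → Matrix (Fin d) (Fin n) ℝ)
        (x : ℕ → Fin n → ℝ) (x0 : Fin n → ℝ) (εA εB δ Γ σR : ℝ),
        d ≤ n →
        Q.PosDef → Qf.PosDef → R.PosDef →
        -- `σR` is a lower bound on the singular values of `R`, with `σR = σ̲(R) ≥ 1`
        1 ≤ σR →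
        (∀ v : Fin d → ℝ, σR * vnorm v ≤ vnorm (R.mulVec v)) →
        -- optimal Riccati recursion
        Pstar H = Qf →
        (∀ t, t < H → Pstar t =
          Q + (A t)ᵀ * Pstar (t+1) * (1 + B t * R⁻¹ * (B t)ᵀ * Pstar (t+1))⁻¹ * A t) →
        (∀ t, t < H → Kstar t =
          -((R + (B t)ᵀ * Pstar (t+1) * B t)⁻¹ * ((B t)ᵀ * Pstar (t+1) * A t))) →
        -- ILC recursion
        PILC H = Qf →
        (∀ t, t < H → PILC t =
          Q + (Ahat t)ᵀ * PILC (t+1) *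
            (1 + B t * R⁻¹ * (Bhat t)ᵀ * PILC (t+1))⁻¹ * A t) →
        (∀ t, t < H → KILC t =
          -((R + (Bhat t)ᵀ * PILC (t+1) * B t)⁻¹ *
            ((Bhat t)ᵀ * PILC (t+1) * A t))) →
        -- invertibility and singular-value lower bound for `R + B̂ᵀ P^ILC B`
        (∀ t, t < H → IsUnit (R + (Bhat t)ᵀ * PILC (t+1) * B t)) →
        (∀ t, t < H → ∀ v : Fin d → ℝ,
          σR * vnorm v ≤ vnorm ((R + (Bhat t)ᵀ * PILC (t+1) * B t).mulVec v)) →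
        -- the model is exact at every time step except `t = 0`
        (∀ t, 1 ≤ t → t < H → Ahat t = A t) →
        (∀ t, 1 ≤ t → t < H → Bhat t = B t) →
        -- modeling error at the first time step
        mnorm (A 0 - Ahat 0) ≤ εA →
        mnorm (B 0 - Bhat 0) ≤ εB →
        0 < εA → εA < Γ → 0 < εB → εB < Γ →
        -- `Γ = 1 + max_t {‖A_t‖, ‖B_t‖, ‖P*_t‖, ‖K*_t‖}` (as an upper bound)
        (∀ t, t < H → 1 + mnorm (A t) ≤ Γ) →
        (∀ t, t < H → 1 + mnorm (B t) ≤ Γ) →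
        (∀ t, t ≤ H → 1 + mnorm (Pstar t) ≤ Γ) →
        (∀ t, t < H → 1 + mnorm (Kstar t) ≤ Γ) →
        -- stability of the optimal controller
        0 < δ → δ ≤ 1 →
        (∀ t, t < H → mnorm (A t + B t * Kstar t) ≤ 1 - δ) →
        -- closeness of the controllers
        (∀ t, t < H → mnorm (Kstar t - KILC t) ≤ δ / (2 * mnorm (B t))) →
        -- closed-loop trajectory of the ILC controller on the true system
        x 0 = x0 →
        (∀ t, t < H → x (t+1) = (A t + B t * KILC t).mulVec (x t)) →
        (∑ t ∈ Finset.range H,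
            (x t ⬝ᵥ Q.mulVec (x t) +
              (KILC t).mulVec (x t) ⬝ᵥ R.mulVec ((KILC t).mulVec (x t))) +
            x H ⬝ᵥ Qf.mulVec (x H))
          - x0 ⬝ᵥ (Pstar 0).mulVec x0 ≤
        C * d * Γ ^ 9 * vnorm x0 ^ 2 * (εA + εB) ^ 2 := by
  refine ⟨2, by norm_num, ?_⟩
  intro n d H A Ahat B Bhat Q Qf R Ps PI Ks KI x x0 εA εB δ Γ σR _ hQ hQf hR hσ _ hPH hPs hKs
    hIH hPI hKI hu hl hA hB _ hEB hεA hεAΓ hεB hεBΓ _ hBΓ hPΓ _ hδ _ hst _ hx0 hx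
  have hpd : ∀ k, k ≤ H → (Ps (H - k)).PosDef := by
    intro k
    induction k with
    | zero => intro _; simpa [hPH] using hQf
    | succ k ih =>
      intro hk
      have h := hPs (H - (k + 1)) (by omega)
      have e : H - (k + 1) + 1 = H - k := by omega
      rw [e] at h
      exact step_posDef _ _ _ _ _ _ hR (ih (by omega)) hQ h
  have hpd' : ∀ t, t ≤ H → (Ps t).PosDef := by
    intro t ht
    have := hpd (H - t) (by omega)
    rwa [show H - (H - t) = t by omega] at this
  have heq : ∀ k, k < H → PI (H - k) = Ps (H - k) := by
    intro k
    induction k with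
    | zero => intro _; simp [hPH, hIH]
    | succ k ih =>
      intro hk
      have h := hPs (H - (k + 1)) (by omega)
      have h' := hPI (H - (k + 1)) (by omega)
      have e : H - (k + 1) + 1 = H - k := by omega
      rw [e] at h h'
      rw [h, h', ih (by omega), hA _ (by omega) (by omega), hB _ (by omega) (by omega)]
  have heq' : ∀ t, 1 ≤ t → t ≤ H → PI t = Ps t := by
    intro t h1 ht
    have := heq (H - t) (by omega)
    rwa [show H - (H - t) = t by omega] at this
  have hstep : ∀ t, t < H → x t ⬝ᵥ Q.mulVec (x t) +
      (KI t).mulVec (x t) ⬝ᵥ R.mulVec ((KI t).mulVec (x t)) =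
      (x t ⬝ᵥ (Ps t).mulVec (x t) - x (t+1) ⬝ᵥ (Ps (t+1)).mulVec (x (t+1))) +
      (KI t - Ks t).mulVec (x t) ⬝ᵥ (R + (B t)ᵀ * Ps (t+1) * B t).mulVec
        ((KI t - Ks t).mulVec (x t)) := by
    intro t ht
    have h := one_step (A t) (Ps (t+1)) Q (Ps t) (B t) R (Ks t) (KI t) hR (hpd' _ ht)
      (hPs t ht) (hKs t ht)
    have h2 := congrArg (fun M => x t ⬝ᵥ M.mulVec (x t)) h
    simp only [Matrix.add_mulVec (_ + _), Matrix.add_mulVec Q, Matrix.add_mulVec (Ps t),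
      dotProduct_add, quad_eq] at h2
    rw [← hx t ht] at h2
    linarith
  have hzero : ∀ t, 1 ≤ t → t < H → KI t - Ks t = 0 := by
    intro t h1 ht
    rw [hKI t ht, hKs t ht, hB t h1 ht, heq' (t+1) (by omega) ht, sub_self]
  rw [Finset.sum_congr rfl (fun t ht => hstep t (Finset.mem_range.1 ht)), Finset.sum_add_distrib,
    Finset.sum_range_sub' (fun t => x t ⬝ᵥ (Ps t).mulVec (x t)), ← hPH, hx0]
  rcases Nat.eq_zero_or_pos H with rfl | hH
  · have : 0 < Γ := hεA.trans hεAΓ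
    simp only [Finset.range_zero, Finset.sum_empty, hx0]
    have : 0 ≤ 2 * (d:ℝ) * Γ ^ 9 * vnorm x0 ^ 2 * (εA + εB) ^ 2 := by positivity
    linarith
  · rw [Finset.sum_eq_single_of_mem 0 (Finset.mem_range.2 hH)]
    · have h1 : PI (0+1) = Ps (0+1) := heq' 1 le_rfl hH
      have hK0 := hKI 0 hH
      have hu0 := hu 0 hH
      have hl0 := hl 0 hH
      rw [h1] at hK0 hu0 hl0
      have := err_bound (A 0) (Ps (0+1)) (B 0) (Bhat 0) R (Ks 0) (KI 0) (x 0) εA εB Γ σR hR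
        (hpd' _ hH) hσ (hKs 0 hH) hK0 hu0 hl0 hEB hεA hεB hεBΓ (hBΓ 0 hH) (hPΓ _ hH)
        ((hst 0 hH).trans (by linarith))
      rw [hx0] at this ⊢
      linarith
    · intro t ht h0
      rw [hzero t (by omega) (Finset.mem_range.1 ht)]
      simp
end
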